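/- Let n ≥ 1 and let ν be an even, finite Borel measure on S^{n−1} with ν(S^{n−1}) > 0. Fix α ≠ 0 and let F be a positive, continuous, α-homogeneous functional on convex bodies of ℝⁿ satisfying property (C), with associated measures σ_K. Suppose K₀ ∈ 𝒦ⁿ_e satisfies F(K₀) = ν(S^{n−1}) and Φ_ν(K₀) = inf{Φ_ν(Q) : Q ∈ 𝒦ⁿ_e, F(Q) = ν(S^{n−1})}. Then ν equals the variational measure V_{F,K₀}, i.e. ν(E) = (1/|α|) ∫_E h_{K₀}(u) dσ_{K₀}(u) for every Borel set E ⊆ S^{n−1}. -/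

import Mathlib

open MeasureTheory Filter Topology
open scoped InnerProductSpace ENNReal Pointwise

noncomputable section

/-- The unit sphere `S^{n-1}` of `ℝⁿ`. -/
def unitSphere (n : ℕ) : Set (EuclideanSpace ℝ (Fin n)) := Metric.sphere 0 1

/-- A convex body: compact, convex, with nonempty interior. -/
def IsConvexBody {n : ℕ} (K : Set (EuclideanSpace ℝ (Fin n))) : Prop :=
  IsCompact K ∧ Convex ℝ K ∧ (interior K).Nonempty

/-- The support function `h_K(u) = sup_{y ∈ K} ⟨y, u⟩`. -/
def suppFn {n : ℕ} (K : Set (EuclideanSpace ℝ (Fin n))) (u : EuclideanSpace ℝ (Fin n)) : ℝ :=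
  sSup ((fun y => ⟪y, u⟫_ℝ) '' K)

/-- The Wulff shape of a function `f` on the sphere. -/
def wulff {n : ℕ} (f : EuclideanSpace ℝ (Fin n) → ℝ) : Set (EuclideanSpace ℝ (Fin n)) :=
  {x | ∀ u ∈ unitSphere n, ⟪x, u⟫_ℝ ≤ f u}

/-- The log-functional `Φ_ν(Q) = ∫ log h_Q dν`. -/
def logFunc {n : ℕ} (ν : Measure (EuclideanSpace ℝ (Fin n)))
    (Q : Set (EuclideanSpace ℝ (Fin n))) : ℝ :=
  ∫ u, Real.log (suppFn Q u) ∂ν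
section Support

variable {n : ℕ} {K : Set (EuclideanSpace ℝ (Fin n))}

lemma bddAbove_inner_image (hK : IsCompact K) (u : EuclideanSpace ℝ (Fin n)) :
    BddAbove ((fun y => ⟪y, u⟫_ℝ) '' K) :=
  (hK.image (by fun_prop)).bddAbove

lemma inner_le_suppFn (hK : IsCompact K) {x : EuclideanSpace ℝ (Fin n)} (hx : x ∈ K)
    (u : EuclideanSpace ℝ (Fin n)) : ⟪x, u⟫_ℝ ≤ suppFn K u :=
  le_csSup (bddAbove_inner_image hK u) ⟨x, hx, rfl⟩

lemma continuous_suppFn (hK : IsCompact K) : Continuous (suppFn K) :=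
  hK.continuous_sSup (f := fun u y => ⟪y, u⟫_ℝ) (by fun_prop)

lemma suppFn_nonneg (hK : IsCompact K) (h0 : 0 ∈ K) (u : EuclideanSpace ℝ (Fin n)) :
    0 ≤ suppFn K u := by
  simpa using inner_le_suppFn hK h0 u

lemma suppFn_pos (hK : IsCompact K) (h0 : 0 ∈ interior K) {u : EuclideanSpace ℝ (Fin n)}
    (hu : u ∈ unitSphere n) : 0 < suppFn K u := by
  obtain ⟨r, hr, hball⟩ := Metric.mem_nhds_iff.1 (mem_interior_iff_mem_nhds.1 h0)
  have hu1 : ‖u‖ = 1 := by simpa [unitSphere] using hu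
  have hmem : (r / 2) • u ∈ K := by
    apply hball
    simp [norm_smul, hu1, abs_of_pos hr, hr]
  have := inner_le_suppFn hK hmem u
  rw [real_inner_smul_left, real_inner_self_eq_norm_sq, hu1] at this
  linarith

lemma suppFn_smul {c : ℝ} (hc : 0 ≤ c) (u : EuclideanSpace ℝ (Fin n)) :
    suppFn (c • K) u = c * suppFn K u := by
  unfold suppFn
  rw [← smul_eq_mul, ← Real.sSup_smul_of_nonneg hc]
  congr 1
  ext y
  simp [Set.mem_smul_set, real_inner_smul_left]

lemma suppFn_neg_of_symm (hK : K = -K) (u : EuclideanSpace ℝ (Fin n)) :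
    suppFn K (-u) = suppFn K u := by
  unfold suppFn
  congr 1
  conv_lhs => rw [hK]
  ext y
  constructor
  · rintro ⟨x, hx, rfl⟩
    exact ⟨-x, hx, by simp⟩
  · rintro ⟨x, hx, rfl⟩
    exact ⟨-x, by simpa using hx, by simp⟩

lemma IsConvexBody.zero_mem_interior (hK : IsConvexBody K) (hsym : K = -K) :
    0 ∈ interior K := by
  obtain ⟨x, hx⟩ := hK.2.2
  have hx' : -x ∈ interior K := by
    rw [hsym] at hx
    exact ((Homeomorph.neg (EuclideanSpace ℝ (Fin n))).preimage_interior K).ge hx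
  have := hK.2.1.interior.midpoint_mem hx hx'
  simpa [midpoint_self_neg] using this

lemma IsConvexBody.smul (hK : IsConvexBody K) {c : ℝ} (hc : 0 < c) :
    IsConvexBody (c • K) := by
  refine ⟨hK.1.smul c, hK.2.1.smul c, ?_⟩
  rw [interior_smul₀ hc.ne']
  exact hK.2.2.smul_set

end Support

section Wulff

variable {n : ℕ} {g : EuclideanSpace ℝ (Fin n) → ℝ}

lemma isClosed_wulff : IsClosed (wulff g) := by
  have : wulff g = ⋂ u ∈ unitSphere n, {x | ⟪x, u⟫_ℝ ≤ g u} := by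
    ext; simp [wulff]
  rw [this]
  exact isClosed_biInter fun u _ => isClosed_le (by fun_prop) continuous_const

lemma convex_wulff : Convex ℝ (wulff g) := by
  intro x hx y hy a b ha hb hab u hu
  rw [inner_add_left, real_inner_smul_left, real_inner_smul_left]
  calc a * ⟪x, u⟫_ℝ + b * ⟪y, u⟫_ℝ ≤ a * g u + b * g u := by
        gcongr
        exacts [hx u hu, hy u hu]
    _ = g u := by rw [← add_mul, hab, one_mul]

lemma isBounded_wulff (hg : ContinuousOn g (unitSphere n)) :
    Bornology.IsBounded (wulff g) := by
  obtain ⟨C, hC⟩ := (isCompact_sphere (0 : EuclideanSpace ℝ (Fin n)) 1).bddAbove_image hg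
  refine (Metric.isBounded_closedBall (x := 0) (r := max C 0)).subset fun x hx => ?_
  rw [mem_closedBall_zero_iff]
  by_cases hx0 : x = 0
  · simp [hx0]
  have hn : ‖x‖ ≠ 0 := norm_ne_zero_iff.2 hx0
  have hu : ‖x‖⁻¹ • x ∈ unitSphere n := by
    simp [unitSphere, norm_smul, hn]
  have h1 := hx _ hu
  rw [real_inner_smul_right, real_inner_self_eq_norm_sq, pow_two, inv_mul_cancel_left₀ hn] at h1
  exact (h1.trans (hC ⟨_, hu, rfl⟩)).trans (le_max_left _ _)

lemma zero_mem_interior_wulff (hg : ContinuousOn g (unitSphere n))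
    (hpos : ∀ u ∈ unitSphere n, 0 < g u) : 0 ∈ interior (wulff g) := by
  obtain ⟨r, hr, hrg⟩ : ∃ r > 0, ∀ u ∈ unitSphere n, r ≤ g u :=
    (isCompact_sphere (0 : EuclideanSpace ℝ (Fin n)) 1).exists_forall_le' hg hpos
  rw [mem_interior_iff_mem_nhds, Metric.mem_nhds_iff]
  refine ⟨r, hr, fun x hx u hu => ?_⟩
  have hu1 : ‖u‖ = 1 := by simpa [unitSphere] using hu
  have hx' : ‖x‖ < r := by simpa using hx
  have := real_inner_le_norm x u
  rw [hu1, mul_one] at this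
  linarith [hrg u hu]

lemma isConvexBody_wulff (hg : ContinuousOn g (unitSphere n))
    (hpos : ∀ u ∈ unitSphere n, 0 < g u) : IsConvexBody (wulff g) :=
  ⟨Metric.isCompact_of_isClosed_isBounded isClosed_wulff (isBounded_wulff hg), convex_wulff,
    ⟨0, zero_mem_interior_wulff hg hpos⟩⟩

lemma wulff_symm (hg : ∀ u, g (-u) = g u) : wulff g = -wulff g := by
  have key : ∀ x ∈ wulff g, -x ∈ wulff g := fun x hx u hu => by
    have := hx (-u) (by simpa [unitSphere] using hu)
    rwa [inner_neg_right, hg, ← inner_neg_left] at this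
  ext x
  exact ⟨fun hx => key x hx, fun hx => by simpa using key _ hx⟩

lemma suppFn_wulff_le (hne : (wulff g).Nonempty) {u : EuclideanSpace ℝ (Fin n)}
    (hu : u ∈ unitSphere n) : suppFn (wulff g) u ≤ g u := by
  apply csSup_le (hne.image _)
  rintro _ ⟨x, hx, rfl⟩
  exact hx u hu

end Wulff

section SphereMeasure

variable {n : ℕ} {μ : Measure (EuclideanSpace ℝ (Fin n))}

lemma integrable_of_continuousOn_unitSphere [IsFiniteMeasure μ] (hμ : μ (unitSphere n)ᶜ = 0)
    {f : EuclideanSpace ℝ (Fin n) → ℝ} (hf : ContinuousOn f (unitSphere n)) :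
    Integrable f μ := by
  rw [← Measure.restrict_eq_self_of_ae_mem (s := unitSphere n) (μ := μ) (ae_iff.2 hμ)]
  exact hf.integrableOn_compact (isCompact_sphere _ _)

lemma integral_comp_neg_of_map_eq (hμ : μ.map (fun x => -x) = μ)
    (f : EuclideanSpace ℝ (Fin n) → ℝ) : ∫ u, f (-u) ∂μ = ∫ u, f u ∂μ := by
  conv_rhs => rw [← hμ]
  exact ((MeasurableEquiv.neg (EuclideanSpace ℝ (Fin n))).measurableEmbedding.integral_map f).symm

end SphereMeasure

/-- Comparing a minimizer of `logFunc` with the rescaled Wulff shapes `[h_K e^{tf}]`. -/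
lemma logFunc_variation_nonneg {n : ℕ}
    {ν : Measure (EuclideanSpace ℝ (Fin n))} [IsFiniteMeasure ν]
    (hν : ν (unitSphere n)ᶜ = 0) {α : ℝ} (hα : α ≠ 0)
    {F : Set (EuclideanSpace ℝ (Fin n)) → ℝ}
    (hFpos : ∀ K, IsConvexBody K → 0 < F K)
    (hFhom : ∀ K, IsConvexBody K → ∀ t : ℝ, 0 < t → F (t • K) = t ^ α * F K)
    {K : Set (EuclideanSpace ℝ (Fin n))} (hK : IsConvexBody K) (hsym : K = -K)
    (hKF : F K = ν.real (unitSphere n))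
    (hmin : ∀ Q, IsConvexBody Q → Q = -Q → F Q = ν.real (unitSphere n) →
      logFunc ν K ≤ logFunc ν Q)
    {f : EuclideanSpace ℝ (Fin n) → ℝ} (hf : Continuous f) (hfe : ∀ u, f (-u) = f u) (t : ℝ) :
    0 ≤ F K / α * (Real.log (F K) -
      Real.log (F (wulff fun u => suppFn K u * Real.exp (t * f u)))) + t * ∫ u, f u ∂ν := by
  set g : EuclideanSpace ℝ (Fin n) → ℝ := fun u => suppFn K u * Real.exp (t * f u) with hg
  have h0 := hK.zero_mem_interior hsym
  have hKpos : ∀ u ∈ unitSphere n, 0 < suppFn K u := fun u hu => suppFn_pos hK.1 h0 hu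
  have hKcont := continuous_suppFn hK.1
  have hgc : ContinuousOn g (unitSphere n) := (by fun_prop : Continuous g).continuousOn
  have hgpos : ∀ u ∈ unitSphere n, 0 < g u := fun u hu => mul_pos (hKpos u hu) (Real.exp_pos _)
  have hL := isConvexBody_wulff hgc hgpos
  have hL0 := zero_mem_interior_wulff hgc hgpos
  have hLsym : wulff g = -wulff g :=
    wulff_symm fun u => by simp only [hg, hfe, suppFn_neg_of_symm hsym]
  set L := wulff g
  have hLpos : ∀ u ∈ unitSphere n, 0 < suppFn L u := fun u hu => suppFn_pos hL.1 hL0 hu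
  have hFL := hFpos L hL
  have hFK := hFpos K hK
  set c : ℝ := (F K / F L) ^ α⁻¹ with hc
  have hcpos : 0 < c := Real.rpow_pos_of_pos (div_pos hFK hFL) _
  have hFc : F (c • L) = ν.real (unitSphere n) := by
    rw [hFhom L hL c hcpos, hc, Real.rpow_inv_rpow (div_pos hFK hFL).le hα,
      div_mul_cancel₀ _ hFL.ne', hKF]
  have hmin' := hmin (c • L) (hL.smul hcpos) (by rw [← Set.smul_set_neg, ← hLsym]) hFc
  have hsphere : ∀ᵐ u ∂ν, u ∈ unitSphere n := ae_iff.2 hν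
  have hintK : Integrable (fun u => Real.log (suppFn K u)) ν :=
    integrable_of_continuousOn_unitSphere hν
      (hKcont.continuousOn.log fun u hu => (hKpos u hu).ne')
  have hintf : Integrable (fun u => t * f u) ν :=
    integrable_of_continuousOn_unitSphere hν (by fun_prop)
  have hintcL : Integrable (fun u => Real.log (suppFn (c • L) u)) ν := by
    refine integrable_of_continuousOn_unitSphere hν
      ((continuous_suppFn (hL.smul hcpos).1).continuousOn.log fun u hu => ?_)
    rw [suppFn_smul hcpos.le]
    exact (mul_pos hcpos (hLpos u hu)).ne'
  have hsum : Integrable (fun u => Real.log (suppFn K u) + t * f u) ν := hintK.add hintf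
  have hupper : logFunc ν (c • L) ≤
      ∫ u, (Real.log c + (Real.log (suppFn K u) + t * f u)) ∂ν := by
    refine integral_mono_ae hintcL ((integrable_const _).add hsum) ?_
    filter_upwards [hsphere] with u hu
    have h1 : Real.log (suppFn L u) ≤ Real.log (suppFn K u) + t * f u := by
      rw [← Real.log_exp (t * f u), ← Real.log_mul (hKpos u hu).ne' (Real.exp_pos _).ne']
      exact Real.log_le_log (hLpos u hu) (suppFn_wulff_le ⟨0, interior_subset hL0⟩ hu)
    rw [suppFn_smul hcpos.le, Real.log_mul hcpos.ne' (hLpos u hu).ne']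
    linarith
  have hmass : ν.real Set.univ = F K := by
    rw [hKF]
    exact (measureReal_congr (eventuallyEq_univ.2 hsphere)).symm
  rw [integral_add (integrable_const _) hsum, integral_add hintK hintf,
    integral_const, integral_const_mul, hmass, smul_eq_mul, hc,
    Real.log_rpow (div_pos hFK hFL), Real.log_div hFK.ne' hFL.ne'] at hupper
  have h2 := hmin'.trans hupper
  unfold logFunc at h2
  have h3 : F K / α * (Real.log (F K) - Real.log (F L)) =
    F K * (α⁻¹ * (Real.log (F K) - Real.log (F L))) := by ring
  rw [h3]
  linarith

/-- The Euler-Lagrange equation of the minimization problem, tested on even functions. -/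
lemma integral_eq_of_even {n : ℕ}
    {ν : Measure (EuclideanSpace ℝ (Fin n))} [IsFiniteMeasure ν]
    (hν : ν (unitSphere n)ᶜ = 0) {α : ℝ} (hα : α ≠ 0)
    {F : Set (EuclideanSpace ℝ (Fin n)) → ℝ}
    (hFpos : ∀ K, IsConvexBody K → 0 < F K)
    (hFhom : ∀ K, IsConvexBody K → ∀ t : ℝ, 0 < t → F (t • K) = t ^ α * F K)
    {K : Set (EuclideanSpace ℝ (Fin n))} (hK : IsConvexBody K) (hsym : K = -K)
    (hKF : F K = ν.real (unitSphere n))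
    (hmin : ∀ Q, IsConvexBody Q → Q = -Q → F Q = ν.real (unitSphere n) →
      logFunc ν K ≤ logFunc ν Q)
    {f : EuclideanSpace ℝ (Fin n) → ℝ} (hf : Continuous f) (hfe : ∀ u, f (-u) = f u)
    {I : ℝ} (hI : Tendsto (fun t : ℝ =>
      (F (wulff (fun u => suppFn K u * Real.exp (t * f u))) - F K) / t)
      (𝓝[≠] (0 : ℝ)) (𝓝 (Real.sign α * I))) :
    ∫ u, f u ∂ν = 1 / |α| * I := by
  set G : ℝ → ℝ :=
    Function.update (fun t => F (wulff fun u => suppFn K u * Real.exp (t * f u))) 0 (F K) with hG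
  have hG0 : G 0 = F K := by simp [hG]
  have hFK := hFpos K hK
  have hderiv : HasDerivAt G (Real.sign α * I) 0 := by
    rw [hasDerivAt_iff_tendsto_slope]
    refine hI.congr' ?_
    filter_upwards [self_mem_nhdsWithin] with t ht
    rw [slope_def_field, hG0, sub_zero, hG, Function.update_of_ne ht]
  have hmin0 : IsLocalMin
      (fun t => F K / α * (Real.log (F K) - Real.log (G t)) + t * ∫ u, f u ∂ν) 0 := by
    refine Filter.Eventually.of_forall fun t => ?_
    simp only [hG0, sub_self, mul_zero, zero_mul, add_zero]
    rcases eq_or_ne t 0 with rfl | ht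
    · simp [hG0]
    · rw [hG, Function.update_of_ne ht]
      exact logFunc_variation_nonneg hν hα hFpos hFhom hK hsym hKF hmin hf hfe t
  have hd := hmin0.hasDerivAt_eq_zero
    ((((hderiv.log (hG0 ▸ hFK.ne')).const_sub (Real.log (F K))).const_mul (F K / α)).add
      ((hasDerivAt_id (0 : ℝ)).mul_const (∫ u, f u ∂ν)))
  rw [hG0] at hd
  have hsign : Real.sign α / α = 1 / |α| := by
    rcases hα.lt_or_gt with h | h
    · rw [Real.sign_of_neg h, abs_of_neg h, neg_div, div_neg]
    · rw [Real.sign_of_pos h, abs_of_pos h]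
  have h1 : F K / α * -(Real.sign α * I / F K) = -(Real.sign α / α * I) := by
    field_simp
  rw [h1, hsign] at hd
  linarith

/-- if the origin-symmetric convex body `K₀` minimizes `Φ_ν` among
origin-symmetric convex bodies `Q` with `F(Q) = ν(S^{n-1})`, and itself satisfies the
constraint, then `ν` is the variational measure `V_{F,K₀}`. -/
theorem minimizer_is_variational_measure (n : ℕ) (hn : 1 ≤ n)
    (ν : Measure (EuclideanSpace ℝ (Fin n))) [IsFiniteMeasure ν]
    (hνsupp : ν (unitSphere n)ᶜ = 0)
    (hνeven : ν.map (fun x => -x) = ν)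
    (hνpos : 0 < ν (unitSphere n))
    (α : ℝ) (hα : α ≠ 0)
    (F : Set (EuclideanSpace ℝ (Fin n)) → ℝ)
    (hFpos : ∀ K, IsConvexBody K → 0 < F K)
    (hFcont : ∀ (K : ℕ → Set (EuclideanSpace ℝ (Fin n))) (L),
      (∀ i, IsConvexBody (K i)) → IsConvexBody L →
      Tendsto (fun i => Metric.hausdorffDist (K i) L) atTop (𝓝 0) →
      Tendsto (fun i => F (K i)) atTop (𝓝 (F L)))
    (hFhom : ∀ K, IsConvexBody K → ∀ t : ℝ, 0 < t → F (t • K) = t ^ α * F K)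
    -- property (C): Hadamard derivative, with associated measures `σ K`
    (σ : Set (EuclideanSpace ℝ (Fin n)) → Measure (EuclideanSpace ℝ (Fin n)))
    (hσfin : ∀ K, IsFiniteMeasure (σ K))
    (hσsupp : ∀ K, (σ K) (unitSphere n)ᶜ = 0)
    (hσeven : ∀ K, IsConvexBody K → K = -K → (σ K).map (fun x => -x) = σ K)
    (hC : ∀ K, IsConvexBody K → 0 ∈ interior K →
      ∀ f : EuclideanSpace ℝ (Fin n) → ℝ, Continuous f →
      Tendsto (fun t : ℝ =>
          (F (wulff (fun u => suppFn K u * Real.exp (t * f u))) - F K) / t)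
        (𝓝[≠] (0 : ℝ))
        (𝓝 (Real.sign α * ∫ u, suppFn K u * f u ∂(σ K))))
    (K₀ : Set (EuclideanSpace ℝ (Fin n)))
    (hK₀ : IsConvexBody K₀) (hK₀sym : K₀ = -K₀)
    (hK₀F : F K₀ = (ν (unitSphere n)).toReal)
    (hK₀min : ∀ Q, IsConvexBody Q → Q = -Q → F Q = (ν (unitSphere n)).toReal →
      logFunc ν K₀ ≤ logFunc ν Q) :
    ν = (σ K₀).withDensity (fun u => ENNReal.ofReal ((1 / |α|) * suppFn K₀ u)) := by
  have := hσfin K₀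
  have h0 := hK₀.zero_mem_interior hK₀sym
  have hh := continuous_suppFn hK₀.1
  have hnn : ∀ u, 0 ≤ 1 / |α| * suppFn K₀ u := fun u =>
    mul_nonneg (by positivity) (suppFn_nonneg hK₀.1 (interior_subset h0) u)
  have hint : ∀ f : EuclideanSpace ℝ (Fin n) → ℝ, Continuous f →
      Integrable (fun u => suppFn K₀ u * f u) (σ K₀) := fun f hf =>
    integrable_of_continuousOn_unitSphere (hσsupp K₀) (hh.mul hf).continuousOn
  have hfin : IsFiniteMeasure
      ((σ K₀).withDensity fun u => ENNReal.ofReal ((1 / |α|) * suppFn K₀ u)) :=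
    isFiniteMeasure_withDensity_ofReal
      (integrable_of_continuousOn_unitSphere (hσsupp K₀)
        (hh.const_mul (1 / |α|)).continuousOn).hasFiniteIntegral
  refine ext_of_forall_integral_eq_of_IsFiniteMeasure fun f => ?_
  have hf := f.continuous
  have hf' : Continuous fun u => f (-u) := hf.comp continuous_neg
  have hmain := integral_eq_of_even hνsupp hα hFpos hFhom hK₀ hK₀sym hK₀F hK₀min
    (f := fun u => f u + f (-u)) (hf.add hf') (fun u => by rw [neg_neg, add_comm])
    (hC K₀ hK₀ h0 _ (hf.add hf'))
  have hsplit : ∫ u, suppFn K₀ u * (f u + f (-u)) ∂(σ K₀) =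
      2 * ∫ u, suppFn K₀ u * f u ∂(σ K₀) := by
    have hneg := integral_comp_neg_of_map_eq (hσeven K₀ hK₀ hK₀sym) fun u => suppFn K₀ u * f u
    simp only [suppFn_neg_of_symm hK₀sym] at hneg
    simp only [mul_add]
    rw [integral_add (hint _ hf) (hint _ hf'), hneg, two_mul]
  rw [integral_add (integrable_of_continuousOn_unitSphere hνsupp hf.continuousOn)
    (integrable_of_continuousOn_unitSphere hνsupp hf'.continuousOn),
    integral_comp_neg_of_map_eq hνeven f, hsplit] at hmain
  rw [integral_withDensity_eq_integral_toReal_smul (by fun_prop)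
    (.of_forall fun _ => ENNReal.ofReal_lt_top)]
  simp only [ENNReal.toReal_ofReal (hnn _), smul_eq_mul, mul_assoc]
  rw [integral_const_mul]
  linarith
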